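/- arXiv:2404.04938 — 3 statements merged into one kernel-verified Lean document; each statement's English description precedes it below -/
import Mathlib

section
/- For all measurable sets E, F ⊆ ℝ^d and α ∈ (0,1), the fractional perimeter satisfies P_α(E \ F) + P_α(F \ E) ≤ P_α(E) + P_α(F). -/
open MeasureTheory Filter
open scoped ENNReal symmDiff

/-- The fractional perimeter `P_α(E) = 2 ∫_E ∫_{E^c} |x-y|^{-(d+α)} dx dy`,
with values in `[0,∞]`. -/
noncomputable def fracPer (d : ℕ) (α : ℝ) (E : Set (EuclideanSpace ℝ (Fin d))) : ℝ≥0∞ :=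
  2 * ∫⁻ x in E, ∫⁻ y in Eᶜ, ENNReal.ofReal (‖x - y‖ ^ (-((d : ℝ) + α)))

/-- The interaction of two sets. -/
noncomputable def fracInter (d : ℕ) (α : ℝ) (X Y : Set (EuclideanSpace ℝ (Fin d))) : ℝ≥0∞ :=
  ∫⁻ x in X, ∫⁻ y in Y, ENNReal.ofReal (‖x - y‖ ^ (-((d : ℝ) + α)))

theorem fracInter_meas (d : ℕ) (α : ℝ) :
    Measurable (fun p : EuclideanSpace ℝ (Fin d) × EuclideanSpace ℝ (Fin d) =>
      ENNReal.ofReal (‖p.1 - p.2‖ ^ (-((d : ℝ) + α)))) := by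
  fun_prop

theorem fracInter_comm (d : ℕ) (α : ℝ) (X Y : Set (EuclideanSpace ℝ (Fin d))) :
    fracInter d α X Y = fracInter d α Y X := by
  unfold fracInter
  rw [lintegral_lintegral_swap (fracInter_meas d α).aemeasurable]
  simp only [norm_sub_rev]

theorem fracInter_union_left (d : ℕ) (α : ℝ) (X X' Y : Set (EuclideanSpace ℝ (Fin d)))
    (h : MeasurableSet X') (hd : Disjoint X X') :
    fracInter d α (X ∪ X') Y = fracInter d α X Y + fracInter d α X' Y := by
  unfold fracInter
  rw [lintegral_union h hd]

theorem fracInter_union_right (d : ℕ) (α : ℝ) (X X' Y : Set (EuclideanSpace ℝ (Fin d)))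
    (h : MeasurableSet X') (hd : Disjoint X X') :
    fracInter d α Y (X ∪ X') = fracInter d α Y X + fracInter d α Y X' := by
  rw [fracInter_comm, fracInter_union_left d α X X' Y h hd, fracInter_comm d α X,
    fracInter_comm d α X']

/-- `P_α(E \ F) + P_α(F \ E) ≤ P_α(E) + P_α(F)`. -/
theorem fracPer_sdiff_inequality (d : ℕ) (α : ℝ) (hα : α ∈ Set.Ioo (0 : ℝ) 1)
    (E F : Set (EuclideanSpace ℝ (Fin d)))
    (hE : MeasurableSet E) (hF : MeasurableSet F) :
    fracPer d α (E \ F) + fracPer d α (F \ E) ≤ fracPer d α E + fracPer d α F := by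
  have key : ∀ X, fracPer d α X = 2 * fracInter d α X Xᶜ := fun X => rfl
  obtain ⟨A, hA⟩ : ∃ A, A = E \ F := ⟨_, rfl⟩
  obtain ⟨B, hB⟩ : ∃ B, B = F \ E := ⟨_, rfl⟩
  obtain ⟨C, hC⟩ : ∃ C, C = E ∩ F := ⟨_, rfl⟩
  obtain ⟨D, hD⟩ : ∃ D, D = (E ∪ F)ᶜ := ⟨_, rfl⟩
  have mC : MeasurableSet C := hC ▸ hE.inter hF
  have mD : MeasurableSet D := hD ▸ (hE.union hF).compl
  have e1 : Aᶜ = (B ∪ C) ∪ D := by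
    subst hA hB hC hD; ext x; simp <;> tauto
  have e2 : Bᶜ = (A ∪ C) ∪ D := by
    subst hA hB hC hD; ext x; simp <;> tauto
  have e3 : E = A ∪ C := by
    subst hA hC; ext x; simp <;> tauto
  have e4 : F = B ∪ C := by
    subst hB hC; ext x; simp <;> tauto
  have e5 : Eᶜ = B ∪ D := by
    subst hB hD; ext x; simp <;> tauto
  have e6 : Fᶜ = A ∪ D := by
    subst hA hD; ext x; simp <;> tauto
  have dAC : Disjoint A C := by
    subst hA hC; rw [Set.disjoint_left]; intro x; simp <;> tauto
  have dBC : Disjoint B C := by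
    subst hB hC; rw [Set.disjoint_left]; intro x; simp <;> tauto
  have dAD : Disjoint A D := by
    subst hA hD; rw [Set.disjoint_left]; intro x; simp <;> tauto
  have dBD : Disjoint B D := by
    subst hB hD; rw [Set.disjoint_left]; intro x; simp <;> tauto
  have dCD : Disjoint C D := by
    subst hC hD; rw [Set.disjoint_left]; intro x; simp <;> tauto
  have p1 : fracInter d α A Aᶜ = fracInter d α A B + fracInter d α A C + fracInter d α A D := by
    rw [e1, fracInter_union_right _ _ _ _ _ mD (dBD.union_left dCD),
      fracInter_union_right _ _ _ _ _ mC dBC]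
  have p2 : fracInter d α B Bᶜ = fracInter d α B A + fracInter d α B C + fracInter d α B D := by
    rw [e2, fracInter_union_right _ _ _ _ _ mD (dAD.union_left dCD),
      fracInter_union_right _ _ _ _ _ mC dAC]
  have p3 : fracInter d α E Eᶜ = (fracInter d α A B + fracInter d α A D)
      + (fracInter d α C B + fracInter d α C D) := by
    rw [e5, e3, fracInter_union_left _ _ _ _ _ mC dAC,
      fracInter_union_right _ _ _ _ _ mD dBD, fracInter_union_right _ _ _ _ _ mD dBD]
  have p4 : fracInter d α F Fᶜ = (fracInter d α B A + fracInter d α B D)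
      + (fracInter d α C A + fracInter d α C D) := by
    rw [e6, e4, fracInter_union_left _ _ _ _ _ mC dBC,
      fracInter_union_right _ _ _ _ _ mD dAD, fracInter_union_right _ _ _ _ _ mD dAD]
  rw [← hA, ← hB, key, key, key, key, p1, p2, p3, p4, fracInter_comm d α C B,
    fracInter_comm d α C A, ← mul_add, ← mul_add]
  refine mul_le_mul_right ?_ 2
  refine le_trans (le_add_of_nonneg_right (zero_le (a := fracInter d α C D + fracInter d α C D))) ?_
  apply le_of_eq
  ring
end

section
/- Let α ∈ (0,1), Ω ⊆ ℝ^d open and bounded, φ ∈ C_c^∞(Ω, ℝ^d) with Lipschitz constant L, and define f_t := I + tφ. Then there exist ε₀ > 0 and a constant C > 0 (depending on φ, d, α) such that for all |t| < ε₀ and all measurable E, F ⊆ Ω with P_α(E) < ∞, one has |λ(f_t(E) ∩ F) − λ(E ∩ F)| ≤ C |t|^α P_α(E); in particular λ(f_t(E) △ E) ≤ C |t|^α P_α(E). -/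
open MeasureTheory Filter
open scoped ENNReal NNReal symmDiff

namespace FracAux

variable {d : ℕ}

local notation "V" => EuclideanSpace ℝ (Fin d)

lemma meas_k (p : ℝ) : Measurable (fun q : V × V => ENNReal.ofReal (‖q.1 - q.2‖ ^ (-p))) := by
  fun_prop

lemma swap_k (p : ℝ) (G H : Set V) :
    ∫⁻ x in G, ∫⁻ y in H, ENNReal.ofReal (‖x - y‖ ^ (-p)) =
    ∫⁻ x in H, ∫⁻ y in G, ENNReal.ofReal (‖x - y‖ ^ (-p)) := by
  rw [lintegral_lintegral_swap (meas_k p).aemeasurable]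
  simp_rw [norm_sub_rev]

lemma ball_bound {p : ℝ} (hp : 0 < p) {ρ : ℝ} (H : Set V) (hH : MeasurableSet H)
    (x : V) (hx : x ∉ H) :
    volume (Metric.ball x ρ ∩ H) ≤
      ENNReal.ofReal (ρ ^ p) * ∫⁻ y in H, ENNReal.ofReal (‖x - y‖ ^ (-p)) := by
  rw [← lintegral_const_mul _ (by fun_prop), ← Measure.restrict_apply Metric.isOpen_ball.measurableSet,
    ← lintegral_indicator_one Metric.isOpen_ball.measurableSet]
  refine setLIntegral_mono' hH fun y hy => ?_
  by_cases hb : y ∈ Metric.ball x ρ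
  · have hne : 0 < ‖x - y‖ := norm_pos_iff.2 (sub_ne_zero.2 (fun h => hx (h ▸ hy)))
    have hl : ‖x - y‖ < ρ := by rwa [← dist_eq_norm, dist_comm]
    rw [Set.indicator_of_mem hb, ← ENNReal.ofReal_mul (Real.rpow_nonneg (hne.le.trans hl.le) _)]
    simp only [Pi.one_apply]
    rw [ENNReal.one_le_ofReal, Real.rpow_neg hne.le, ← div_eq_mul_inv,
      one_le_div (by positivity)]
    exact Real.rpow_le_rpow hne.le hl.le hp.le
  · rw [Set.indicator_of_notMem hb]; exact zero_le

lemma key {p : ℝ} (hp : 0 < p) {r : ℝ} (f : V → V) (hf : Measurable f)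
    (hfr : ∀ x, ‖f x - x‖ ≤ r)
    (hmap : Measure.map f volume ≤ (2 : ℝ≥0∞) • (volume : Measure V))
    (G : Set V) (hG : MeasurableSet G) :
    volume (Metric.ball (0 : V) r) * volume (G ∩ f ⁻¹' Gᶜ) ≤
      (ENNReal.ofReal (r ^ p) + 2 * ENNReal.ofReal ((2 * r) ^ p)) *
        ∫⁻ x in G, ∫⁻ y in Gᶜ, ENNReal.ofReal (‖x - y‖ ^ (-p)) := by
  set A := G ∩ f ⁻¹' Gᶜ with hA
  have hAm : MeasurableSet A := hG.inter (hf hG.compl)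
  have hψ : ∀ H : Set V, Measurable
      (fun x : V => ∫⁻ y in H, ENNReal.ofReal (‖x - y‖ ^ (-p))) := fun H =>
    Measurable.lintegral_prod_right' (meas_k p)
  have h1 : volume (Metric.ball (0 : V) r) * volume A
      = ∫⁻ x in A, volume (Metric.ball x r) := by
    simp_rw [fun x : V => Measure.addHaar_ball_center (volume : Measure V) x r]
    simp
  rw [h1]
  calc ∫⁻ x in A, volume (Metric.ball x r)
      ≤ ∫⁻ x in A, (ENNReal.ofReal (r ^ p) * (∫⁻ y in Gᶜ, ENNReal.ofReal (‖x - y‖ ^ (-p)))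
          + ENNReal.ofReal ((2 * r) ^ p) *
            (∫⁻ y in G, ENNReal.ofReal (‖f x - y‖ ^ (-p)))) := by
        refine setLIntegral_mono' hAm fun x hx => ?_
        have hsub : Metric.ball x r ⊆
            (Metric.ball x r ∩ Gᶜ) ∪ (Metric.ball (f x) (2 * r) ∩ G) := by
          intro z hz
          by_cases hzG : z ∈ G
          · refine Or.inr ⟨?_, hzG⟩
            have := hfr x
            rw [Metric.mem_ball] at hz ⊢
            have h3 := dist_triangle z x (f x)
            rw [← dist_eq_norm, dist_comm] at this
            linarith
          · exact Or.inl ⟨hz, hzG⟩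
        refine (measure_mono hsub).trans ((measure_union_le _ _).trans (add_le_add ?_ ?_))
        · exact ball_bound hp _ hG.compl x (fun h => h hx.1)
        · exact ball_bound hp _ hG (f x) hx.2
    _ = ENNReal.ofReal (r ^ p) * (∫⁻ x in A, ∫⁻ y in Gᶜ, ENNReal.ofReal (‖x - y‖ ^ (-p)))
          + ENNReal.ofReal ((2 * r) ^ p) *
            (∫⁻ x in A, ∫⁻ y in G, ENNReal.ofReal (‖f x - y‖ ^ (-p))) := by
        rw [lintegral_add_left ((hψ _).const_mul _), lintegral_const_mul _ (hψ _),
          lintegral_const_mul _ (show Measurable (fun x => ∫⁻ y in G, ENNReal.ofReal (‖f x - y‖ ^ (-p)))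
            from (hψ G).comp hf)]
    _ ≤ ENNReal.ofReal (r ^ p) * (∫⁻ x in G, ∫⁻ y in Gᶜ, ENNReal.ofReal (‖x - y‖ ^ (-p)))
          + ENNReal.ofReal ((2 * r) ^ p) *
            (2 * ∫⁻ x in G, ∫⁻ y in Gᶜ, ENNReal.ofReal (‖x - y‖ ^ (-p))) := by
        refine add_le_add (mul_le_mul_right ?_ _) (mul_le_mul_right ?_ _)
        · exact lintegral_mono_set Set.inter_subset_left
        · calc ∫⁻ x in A, ∫⁻ y in G, ENNReal.ofReal (‖f x - y‖ ^ (-p))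
              ≤ ∫⁻ x in f ⁻¹' Gᶜ, ∫⁻ y in G, ENNReal.ofReal (‖f x - y‖ ^ (-p)) :=
                lintegral_mono_set Set.inter_subset_right
            _ = ∫⁻ x in Gᶜ, (∫⁻ y in G, ENNReal.ofReal (‖x - y‖ ^ (-p))) ∂(Measure.map f volume) :=
                (setLIntegral_map hG.compl (hψ G) hf).symm
            _ ≤ ∫⁻ x in Gᶜ, (∫⁻ y in G, ENNReal.ofReal (‖x - y‖ ^ (-p)))
                  ∂((2 : ℝ≥0∞) • (volume : Measure V)) :=
                lintegral_mono' (Measure.restrict_mono le_rfl hmap) le_rfl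
            _ = _ := by
                rw [Measure.restrict_smul, lintegral_smul_measure, swap_k, smul_eq_mul]
    _ = _ := by ring

lemma approx (φ : V → V) (L : ℝ≥0) (hL : LipschitzWith L φ) (t : ℝ) :
    ApproximatesLinearOn (fun x => x + t • φ x)
      ((ContinuousLinearEquiv.refl ℝ V : V ≃L[ℝ] V) : V →L[ℝ] V) Set.univ (‖t‖₊ * L) := by
  intro x _ y _
  have := hL.norm_sub_le x y
  have h : (x + t • φ x) - (y + t • φ y) -
    ((ContinuousLinearEquiv.refl ℝ V : V ≃L[ℝ] V) : V →L[ℝ] V) (x - y) = t • (φ x - φ y) := by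
    simp [smul_sub]; abel
  rw [h, norm_smul]
  push_cast
  rw [mul_assoc]
  gcongr

lemma exists_eps (φ : V → V) (L : ℝ≥0) (hL : LipschitzWith L φ) :
    ∃ ε > (0 : ℝ), ∀ t : ℝ, |t| < ε →
      Function.Bijective (fun x => x + t • φ x) ∧
      (∀ s : Set V, volume ((fun x => x + t • φ x) '' s) ≤ 2 * volume s) ∧
      (∀ s : Set V, volume s ≤ 2 * volume ((fun x => x + t • φ x) '' s)) := by
  have hdet : (((ContinuousLinearEquiv.refl ℝ V : V ≃L[ℝ] V) : V →L[ℝ] V)).det = 1 := by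
    simp [ContinuousLinearMap.det]
  have e1 := addHaar_image_le_mul_of_det_lt (volume : Measure V)
    ((ContinuousLinearEquiv.refl ℝ V : V ≃L[ℝ] V) : V →L[ℝ] V) (m := 2) (by simp [hdet, -ContinuousLinearEquiv.coe_refl])
  have e2 := mul_le_addHaar_image_of_lt_det (volume : Measure V)
    ((ContinuousLinearEquiv.refl ℝ V : V ≃L[ℝ] V) : V →L[ℝ] V) (m := 1/2) (by simp [hdet, -ContinuousLinearEquiv.coe_refl])
  obtain ⟨δ, ⟨h1, h2⟩, h3⟩ := ((e1.and e2).and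
    (Ioo_mem_nhdsGT (show (0 : ℝ≥0) < 1/2 by norm_num))).exists
  have hδ := h3.1
  refine ⟨δ / (L + 1), by positivity, fun t ht => ?_⟩
  have hle : ‖t‖₊ * L ≤ δ := by
    rw [← NNReal.coe_le_coe]
    push_cast
    rw [Real.norm_eq_abs]
    rw [lt_div_iff₀ (by positivity)] at ht
    nlinarith [abs_nonneg t]
  have ha := (approx φ L hL t).mono_num hle
  refine ⟨?_, fun s => ?_, fun s => ?_⟩
  · have hc : Subsingleton V ∨ δ < ‖((ContinuousLinearEquiv.refl ℝ V).symm : V →L[ℝ] V)‖₊⁻¹ := by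
      rcases subsingleton_or_nontrivial V with h | h
      · exact Or.inl h
      · right
        have : ‖((ContinuousLinearEquiv.refl ℝ V).symm : V →L[ℝ] V)‖₊ = 1 := by
          ext; simp
        rw [this]
        refine h3.2.trans (by norm_num)
    exact (ha.toHomeomorph _ hc).bijective
  · simpa using h1 s _ (ha.mono_set (Set.subset_univ _))
  · have := h2 s _ (ha.mono_set (Set.subset_univ _))
    have h4 : (2 : ℝ≥0∞) * (((1/2 : ℝ≥0) : ℝ≥0∞) * volume s) = volume s := by
      rw [← mul_assoc]
      have : (2 : ℝ≥0∞) * ((1/2 : ℝ≥0) : ℝ≥0∞) = 1 := by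
        rw [show (2 : ℝ≥0∞) = ((2 : ℝ≥0) : ℝ≥0∞) by simp, ← ENNReal.coe_mul]; norm_num
      rw [this, one_mul]
    rw [← h4]
    gcongr

lemma key' {α : ℝ} (hα : 0 < α) {r : ℝ} (hr : 0 < r) (f : V → V) (hf : Measurable f)
    (hfr : ∀ x, ‖f x - x‖ ≤ r)
    (hmap : Measure.map f volume ≤ (2 : ℝ≥0∞) • (volume : Measure V))
    (G : Set V) (hG : MeasurableSet G) :
    volume (G ∩ f ⁻¹' Gᶜ) ≤
      ENNReal.ofReal (r ^ α * ((1 + 2 * 2 ^ ((d : ℝ) + α)) /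
          (volume (Metric.ball (0 : V) 1)).toReal)) *
        ∫⁻ x in G, ∫⁻ y in Gᶜ, ENNReal.ofReal (‖x - y‖ ^ (-((d : ℝ) + α))) := by
  have hk := key (p := (d : ℝ) + α) (by positivity) f hf hfr hmap G hG
  have hV0 : volume (Metric.ball (0 : V) 1) ≠ 0 := (Metric.measure_ball_pos _ _ one_pos).ne'
  have hVt : volume (Metric.ball (0 : V) 1) ≠ ⊤ := measure_ball_lt_top.ne
  set c := (volume (Metric.ball (0 : V) 1)).toReal with hc
  have hcpos : 0 < c := ENNReal.toReal_pos hV0 hVt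
  set Q := ∫⁻ x in G, ∫⁻ y in Gᶜ, ENNReal.ofReal (‖x - y‖ ^ (-((d : ℝ) + α)))
  have hball : volume (Metric.ball (0 : V) r) = ENNReal.ofReal (r ^ d * c) := by
    rw [Measure.addHaar_ball_of_pos _ _ hr, ENNReal.ofReal_mul (by positivity),
      hc, ENNReal.ofReal_toReal hVt]
    simp
  have hco : ENNReal.ofReal (r ^ ((d : ℝ) + α)) + 2 * ENNReal.ofReal ((2 * r) ^ ((d : ℝ) + α))
      = ENNReal.ofReal (r ^ d * c) *
        ENNReal.ofReal (r ^ α * ((1 + 2 * 2 ^ ((d : ℝ) + α)) / c)) := by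
    rw [show (2 : ℝ≥0∞) = ENNReal.ofReal 2 by simp, ← ENNReal.ofReal_mul (by positivity),
      ← ENNReal.ofReal_add (by positivity) (by positivity), ← ENNReal.ofReal_mul (by positivity)]
    congr 1
    rw [Real.mul_rpow (by positivity) hr.le, Real.rpow_add hr, Real.rpow_natCast]
    field_simp
  rw [hball, hco, mul_assoc] at hk
  refine (ENNReal.mul_le_mul_iff_right ?_ ENNReal.ofReal_ne_top).1 hk
  simp only [ne_eq, ENNReal.ofReal_eq_zero, not_le]
  positivity

end FracAux

open FracAux in
/-- Symmetric-difference bound for local variations `f_t = I + tφ`: there are `ε₀, C > 0`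
such that for `|t| < ε₀` and measurable `E, F ⊆ Ω` with `P_α(E) < ∞`,
`|λ(f_t(E) ∩ F) − λ(E ∩ F)| ≤ C |t|^α P_α(E)` and `λ(f_t(E) △ E) ≤ C |t|^α P_α(E)`. -/
theorem measure_image_inter_bound (d : ℕ) (α : ℝ) (hα : α ∈ Set.Ioo (0 : ℝ) 1)
    (Ω : Set (EuclideanSpace ℝ (Fin d))) (hΩo : IsOpen Ω) (hΩb : Bornology.IsBounded Ω)
    (φ : EuclideanSpace ℝ (Fin d) → EuclideanSpace ℝ (Fin d))
    (hφ : ContDiff ℝ (⊤ : ℕ∞) φ) (hφs : HasCompactSupport φ) (hφΩ : tsupport φ ⊆ Ω)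
    (L : ℝ≥0) (hL : LipschitzWith L φ) :
    ∃ ε₀ > (0 : ℝ), ∃ C > (0 : ℝ), ∀ t : ℝ, |t| < ε₀ →
      ∀ E F : Set (EuclideanSpace ℝ (Fin d)), MeasurableSet E → MeasurableSet F →
        E ⊆ Ω → F ⊆ Ω → fracPer d α E < ⊤ →
        |(volume ((fun x => x + t • φ x) '' E ∩ F)).toReal - (volume (E ∩ F)).toReal|
            ≤ C * |t| ^ α * (fracPer d α E).toReal ∧
        volume (((fun x => x + t • φ x) '' E) ∆ E)
            ≤ ENNReal.ofReal (C * |t| ^ α) * fracPer d α E := by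
  obtain ⟨hα0, hα1⟩ := hα
  obtain ⟨ε, hε, hf⟩ := exists_eps φ L hL
  obtain ⟨M, hM⟩ := hφs.exists_bound_of_continuous hφ.continuous
  set B : ℝ := |M| + 1 with hB
  have hBpos : 0 < B := by positivity
  have hMB : ∀ x, ‖φ x‖ ≤ B := fun x => (hM x).trans ((le_abs_self M).trans (by simp [hB]))
  have hcpos : 0 < (volume (Metric.ball (0 : EuclideanSpace ℝ (Fin d)) 1)).toReal :=
    ENNReal.toReal_pos (Metric.measure_ball_pos _ _ one_pos).ne' measure_ball_lt_top.ne
  set K : ℝ := (1 + 2 * 2 ^ ((d : ℝ) + α)) /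
          (volume (Metric.ball (0 : EuclideanSpace ℝ (Fin d)) 1)).toReal with hK
  have hKpos : 0 < K := by positivity
  refine ⟨ε, hε, 2 * (B ^ α * K), by positivity, fun t ht E F hE hFm hEΩ hFΩ hP => ?_⟩
  obtain ⟨hbij, hup, hlow⟩ := hf t ht
  have hcont : Continuous (fun x => x + t • φ x) :=
    continuous_id.add (hφ.continuous.const_smul t)
  have hmain : volume (((fun x => x + t • φ x) '' E) ∆ E)
      ≤ ENNReal.ofReal (2 * (B ^ α * K) * |t| ^ α) * fracPer d α E := by
    by_cases ht0 : t = 0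
    · subst ht0; simp
    have htpos : 0 < |t| := abs_pos.2 ht0
    have hfr : ∀ x, ‖(fun x => x + t • φ x) x - x‖ ≤ B * |t| := by
      intro x
      simp only [add_sub_cancel_left, norm_smul, Real.norm_eq_abs]
      rw [mul_comm]
      gcongr
      exact hMB x
    set f := (fun x => x + t • φ x) with hfdef
    have hmap : Measure.map f volume ≤
        (2 : ℝ≥0∞) • (volume : Measure (EuclideanSpace ℝ (Fin d))) := by
      refine Measure.le_iff.2 fun s hs => ?_
      rw [Measure.map_apply hcont.measurable hs]
      refine (hlow _).trans ?_
      rw [Set.image_preimage_eq _ hbij.2]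
      simp
    have k1 := key' hα0 (r := B * |t|) (by positivity) f hcont.measurable hfr hmap E hE
    have k2 := key' hα0 (r := B * |t|) (by positivity) f hcont.measurable hfr hmap Eᶜ hE.compl
    rw [swap_k, compl_compl] at k2
    rw [← hK] at k1 k2
    have s1 : f '' E \ E ⊆ f '' (E ∩ f ⁻¹' Eᶜ) := by
      rintro _ ⟨⟨x, hx, rfl⟩, hy⟩
      exact ⟨x, ⟨hx, hy⟩, rfl⟩
    have s2 : E \ f '' E ⊆ f '' (Eᶜ ∩ f ⁻¹' E) := by
      rintro y ⟨hy, hn⟩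
      obtain ⟨x, rfl⟩ := hbij.2 y
      exact ⟨x, ⟨fun hx => hn ⟨x, hx, rfl⟩, hy⟩, rfl⟩
    have m1 := (measure_mono s1).trans ((hup _).trans (mul_le_mul_right k1 2))
    have m2 := (measure_mono s2).trans ((hup _).trans (mul_le_mul_right k2 2))
    have m3 : volume ((f '' E) ∆ E) ≤ volume (f '' E \ E) + volume (E \ f '' E) :=
      measure_union_le _ _
    refine m3.trans ((add_le_add m1 m2).trans (le_of_eq ?_))
    rw [fracPer, Real.mul_rpow hBpos.le (abs_nonneg t)]
    rw [show 2 * (B ^ α * K) * |t| ^ α = 2 * (B ^ α * |t| ^ α * K) by ring,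
      ENNReal.ofReal_mul (by norm_num : (0 : ℝ) ≤ 2)]
    simp only [ENNReal.ofReal_ofNat]
    ring
  refine ⟨?_, hmain⟩
  have hEfin : volume E ≠ ⊤ := ((measure_mono hEΩ).trans_lt hΩb.measure_lt_top).ne
  have hfEfin : volume ((fun x => x + t • φ x) '' E) ≠ ⊤ :=
    ((hup E).trans_lt (ENNReal.mul_lt_top (by simp) hEfin.lt_top)).ne
  set A := (fun x => x + t • φ x) '' E with hA
  have hSfin : volume (A ∆ E) ≠ ⊤ :=
    (hmain.trans_lt (ENNReal.mul_lt_top ENNReal.ofReal_lt_top hP)).ne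
  have hreal : (volume (A ∆ E)).toReal ≤ 2 * (B ^ α * K) * |t| ^ α * (fracPer d α E).toReal := by
    have := ENNReal.toReal_mono (ENNReal.mul_lt_top ENNReal.ofReal_lt_top hP).ne hmain
    rwa [ENNReal.toReal_mul, ENNReal.toReal_ofReal (by positivity)] at this
  have gen : ∀ X Y : Set (EuclideanSpace ℝ (Fin d)), volume Y ≠ ⊤ → volume (X ∆ Y) ≠ ⊤ →
      (volume (X ∩ F)).toReal ≤ (volume (Y ∩ F)).toReal + (volume (X ∆ Y)).toReal := by
    intro X Y hY hXY
    have hYF : volume (Y ∩ F) ≠ ⊤ := ((measure_mono Set.inter_subset_left).trans_lt hY.lt_top).ne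
    rw [← ENNReal.toReal_add hYF hXY]
    refine ENNReal.toReal_mono (ENNReal.add_ne_top.2 ⟨hYF, hXY⟩) ?_
    refine (measure_mono ?_).trans (measure_union_le _ _)
    rintro x ⟨hx, hxF⟩
    by_cases hxY : x ∈ Y
    · exact Or.inl ⟨hxY, hxF⟩
    · exact Or.inr (Or.inl ⟨hx, hxY⟩)
  have g1 := gen A E hEfin hSfin
  have g2 := gen E A hfEfin (by rwa [symmDiff_comm])
  rw [symmDiff_comm E A] at g2
  rw [abs_le]
  constructor <;> linarith
end

section
/- Let E ⊆ Ω ⊆ ℝ^d be measurable with P_α(E) < ∞ for α ∈ (0,1), let g ∈ C²(closure of Ω), φ ∈ C_c^∞(Ω, ℝ^d), and f_t := I + tφ. Then the L²-pairing satisfies (g, χ_{f_t(E)} − χ_E)_{L²} = t ∫_E div(g(x)φ(x)) dx + O(t²) as t → 0. -/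
open MeasureTheory Filter
open scoped ENNReal NNReal symmDiff

open Asymptotics

/-- Divergence of a vector field on `ℝ^d`. -/
noncomputable def vdiv {d : ℕ}
    (φ : EuclideanSpace ℝ (Fin d) → EuclideanSpace ℝ (Fin d))
    (x : EuclideanSpace ℝ (Fin d)) : ℝ :=
  ∑ i : Fin d, fderiv ℝ φ x (EuclideanSpace.single i 1) i

namespace LinObj

variable {d : ℕ}

/-- The Jacobian matrix of a vector field. -/
noncomputable def jac (φ : EuclideanSpace ℝ (Fin d) → EuclideanSpace ℝ (Fin d))
    (x : EuclideanSpace ℝ (Fin d)) : Matrix (Fin d) (Fin d) ℝ :=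
  Matrix.of fun i j => fderiv ℝ φ x (EuclideanSpace.single j 1) i

theorem det_eq (φ : EuclideanSpace ℝ (Fin d) → EuclideanSpace ℝ (Fin d))
    (x : EuclideanSpace ℝ (Fin d)) (t : ℝ) :
    (ContinuousLinearMap.id ℝ (EuclideanSpace ℝ (Fin d)) + t • fderiv ℝ φ x).det =
      Matrix.det (1 + t • jac φ x) := by
  rw [ContinuousLinearMap.det,
    ← LinearMap.det_toMatrix (EuclideanSpace.basisFun (Fin d) ℝ).toBasis]
  congr 1
  ext i j
  simp [LinearMap.toMatrix_apply, Matrix.one_apply, jac]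

theorem two_le_infty : (2 : WithTop ℕ∞) + 1 ≤ ((⊤ : ℕ∞) : WithTop ℕ∞) := by
  have : ((3 : ℕ∞) : WithTop ℕ∞) ≤ ((⊤ : ℕ∞) : WithTop ℕ∞) := WithTop.coe_le_coe.2 le_top
  refine le_trans (le_of_eq ?_) this
  norm_num

theorem contDiff_two {φ : EuclideanSpace ℝ (Fin d) → EuclideanSpace ℝ (Fin d)}
    (hφ : ContDiff ℝ (⊤ : ℕ∞) φ) : ContDiff ℝ 2 φ :=
  hφ.of_le (le_self_add.trans two_le_infty)

theorem taylor {X : Type*} [NormedAddCommGroup X] [NormedSpace ℝ X] [FiniteDimensional ℝ X]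
    (F : X → ℝ) (hF : ContDiff ℝ 2 F) (R : ℝ) :
    ∃ C : ℝ, 0 ≤ C ∧ ∀ p ∈ Metric.closedBall (0 : X) R, ∀ q ∈ Metric.closedBall (0 : X) R,
      ‖F q - F p - fderiv ℝ F p (q - p)‖ ≤ C * ‖q - p‖ ^ 2 := by
  have h1 : ContDiff ℝ 1 (fderiv ℝ F) := hF.fderiv_right (by norm_num)
  have := FiniteDimensional.proper ℝ X
  obtain ⟨L, hL⟩ := h1.contDiffOn.exists_lipschitzOnWith one_ne_zero
    (convex_closedBall (0 : X) R) (isCompact_closedBall _ _)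
  refine ⟨L, L.2, fun p hp q hq => ?_⟩
  have hseg : segment ℝ p q ⊆ Metric.closedBall (0 : X) R :=
    (convex_closedBall (0 : X) R).segment_subset hp hq
  have := (convex_segment (𝕜 := ℝ) p q).norm_image_sub_le_of_norm_fderiv_le' (𝕜 := ℝ)
    (f := F) (φ := fderiv ℝ F p) (C := L * ‖q - p‖)
    (fun x _ => (hF.differentiable (by norm_num)) x) (fun x hx => by
      refine (hL.norm_sub_le (hseg hx) hp).trans ?_
      gcongr
      exact norm_sub_le_of_mem_segment hx) (left_mem_segment ℝ p q) (right_mem_segment ℝ p q)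
  calc _ ≤ _ := this
    _ = _ := by ring

theorem contDiff_jacdet (φ : EuclideanSpace ℝ (Fin d) → EuclideanSpace ℝ (Fin d))
    (hφ : ContDiff ℝ (⊤ : ℕ∞) φ) :
    ContDiff ℝ 2 (fun p : ℝ × EuclideanSpace ℝ (Fin d) => Matrix.det (1 + p.1 • jac φ p.2)) := by
  have h1 : ContDiff ℝ 2 (fderiv ℝ φ) := hφ.fderiv_right two_le_infty
  have h2 : ∀ i j, ContDiff ℝ 2 (fun x => jac φ x i j) := by
    intro i j
    have h3 : ContDiff ℝ 2 (fun x => fderiv ℝ φ x (EuclideanSpace.single j 1)) :=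
      h1.clm_apply contDiff_const
    exact contDiff_euclidean.1 h3 i
  simp only [Matrix.det_apply]
  refine ContDiff.sum fun σ _ => ContDiff.const_smul _ (contDiff_prod fun i _ => ?_)
  simp only [Matrix.add_apply, Matrix.smul_apply]
  exact contDiff_const.add (contDiff_fst.smul ((h2 _ _).comp contDiff_snd))

theorem vdiv_mul (G : EuclideanSpace ℝ (Fin d) → ℝ) (hG : ContDiff ℝ 2 G)
    (φ : EuclideanSpace ℝ (Fin d) → EuclideanSpace ℝ (Fin d))
    (hφ : ContDiff ℝ (⊤ : ℕ∞) φ) (x : EuclideanSpace ℝ (Fin d)) :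
    vdiv (fun y => G y • φ y) x = fderiv ℝ G x (φ x) + G x * (jac φ x).trace := by
  have hG' : DifferentiableAt ℝ G x := hG.differentiable (by norm_num) x
  have hφ' : DifferentiableAt ℝ φ x := hφ.differentiable (by simp) x
  have hx : φ x = ∑ i, φ x i • EuclideanSpace.single i (1 : ℝ) := by
    ext j
    simp [Finset.sum_apply, Pi.single_apply]
  unfold vdiv
  rw [fderiv_fun_smul hG' hφ']
  conv_rhs => rw [hx]
  simp only [map_sum, map_smul, Matrix.trace, Matrix.diag, jac, Finset.mul_sum,
    ← Finset.sum_add_distrib]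
  refine Finset.sum_congr rfl fun i _ => ?_
  simp
  ring

theorem contDiff_F (G : EuclideanSpace ℝ (Fin d) → ℝ) (hG : ContDiff ℝ 2 G)
    (φ : EuclideanSpace ℝ (Fin d) → EuclideanSpace ℝ (Fin d))
    (hφ : ContDiff ℝ (⊤ : ℕ∞) φ) :
    ContDiff ℝ 2 (fun p : ℝ × EuclideanSpace ℝ (Fin d) =>
      G (p.2 + p.1 • φ p.2) * Matrix.det (1 + p.1 • jac φ p.2)) := by
  have h2 : ContDiff ℝ 2 φ := contDiff_two hφ
  exact (hG.comp (contDiff_snd.add (contDiff_fst.smul (h2.comp contDiff_snd)))).mul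
    (contDiff_jacdet φ hφ)

theorem hasDerivAt_jacdet (M : Matrix (Fin d) (Fin d) ℝ) :
    HasDerivAt (fun t : ℝ => Matrix.det (1 + t • M)) M.trace 0 := by
  rw [funext fun t : ℝ => Matrix.det_one_add_smul t M]
  have h1 := (Polynomial.hasDerivAt
    (Matrix.det (1 + (Polynomial.X : Polynomial ℝ) • M.map Polynomial.C)).divX.divX (0:ℝ)).mul
    (hasDerivAt_pow 2 (0:ℝ))
  have h2 := (((hasDerivAt_id (0:ℝ)).const_mul M.trace).const_add 1).add h1
  exact h2.congr_deriv (by simp)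

theorem fderiv_F (G : EuclideanSpace ℝ (Fin d) → ℝ) (hG : ContDiff ℝ 2 G)
    (φ : EuclideanSpace ℝ (Fin d) → EuclideanSpace ℝ (Fin d))
    (hφ : ContDiff ℝ (⊤ : ℕ∞) φ) (x : EuclideanSpace ℝ (Fin d)) (t : ℝ) :
    fderiv ℝ (fun p : ℝ × EuclideanSpace ℝ (Fin d) =>
      G (p.2 + p.1 • φ p.2) * Matrix.det (1 + p.1 • jac φ p.2)) (0, x) (t, 0) =
      t * vdiv (fun y => G y • φ y) x := by
  rw [vdiv_mul G hG φ hφ]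
  have hF := ((contDiff_F G hG φ hφ).differentiable (by norm_num) (0, x)).hasFDerivAt
  have hl : HasDerivAt (fun t : ℝ => ((t, x) : ℝ × EuclideanSpace ℝ (Fin d))) (1, 0) 0 :=
    (hasDerivAt_id (0:ℝ)).prodMk (hasDerivAt_const _ _)
  have h1 := hF.comp_hasDerivAt (0:ℝ) hl
  have hGx : HasFDerivAt G (fderiv ℝ G x) (x + (0:ℝ) • φ x) := by
    simpa using (hG.differentiable (by norm_num) x).hasFDerivAt
  have hl2 : HasDerivAt (fun t : ℝ => x + t • φ x) (φ x) 0 := by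
    simpa using ((hasDerivAt_id (0:ℝ)).smul_const (φ x)).const_add x
  have h2 := (hGx.comp_hasDerivAt (0:ℝ) hl2).mul (hasDerivAt_jacdet (jac φ x))
  have h3 := h1.unique h2
  have h4 : ((t, 0) : ℝ × EuclideanSpace ℝ (Fin d)) = t • (1, 0) := by simp
  rw [h4, map_smul, h3]
  simp

/-- Cutoff of `g`. -/
theorem exists_cutoff (Ω : Set (EuclideanSpace ℝ (Fin d))) (hΩo : IsOpen Ω)
    (g : EuclideanSpace ℝ (Fin d) → ℝ) (hg : ContDiffOn ℝ 2 g (closure Ω))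
    (K : Set (EuclideanSpace ℝ (Fin d))) (hK : IsClosed K) (hKΩ : K ⊆ Ω) :
    ∃ G : EuclideanSpace ℝ (Fin d) → ℝ, ContDiff ℝ 2 G ∧ ∀ x ∈ K, G x = g x := by
  obtain ⟨η, h0, h1, -⟩ := exists_contMDiffMap_zero_one_nhds_of_isClosed
    (modelWithCornersSelf ℝ (EuclideanSpace ℝ (Fin d))) (n := 2) hΩo.isClosed_compl hK
    (Set.disjoint_left.2 fun x hx hx' => hx (hKΩ hx'))
  have hη : ContDiff ℝ 2 η := η.contMDiff.contDiff
  refine ⟨fun x => η x * g x, ?_, fun x hx => ?_⟩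
  · rw [contDiff_iff_contDiffAt]
    intro x
    by_cases hx : x ∈ Ω
    · exact hη.contDiffAt.mul (hg.contDiffAt (mem_of_superset (hΩo.mem_nhds hx) subset_closure))
    · have : ∀ᶠ y in nhds x, η y = 0 := (eventually_nhdsSet_iff_forall.1 h0) x hx
      refine (contDiffAt_const (c := (0:ℝ))).congr_of_eventuallyEq ?_
      filter_upwards [this] with y hy
      simp [hy]
  · have := h1.self_of_nhdsSet x hx
    simp [this]

end LinObj

open LinObj in
/-- Variation of the linearized objective:
`(g, χ_{f_t(E)} − χ_E)_{L²} = t ∫_E div(g φ) dx + O(t²)` as `t → 0`. -/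
theorem linearized_objective_variation (d : ℕ) (α : ℝ) (hα : α ∈ Set.Ioo (0 : ℝ) 1)
    (Ω : Set (EuclideanSpace ℝ (Fin d))) (hΩo : IsOpen Ω) (hΩb : Bornology.IsBounded Ω)
    (E : Set (EuclideanSpace ℝ (Fin d))) (hE : MeasurableSet E) (hEΩ : E ⊆ Ω)
    (hfin : fracPer d α E < ⊤)
    (g : EuclideanSpace ℝ (Fin d) → ℝ) (hg : ContDiffOn ℝ 2 g (closure Ω))
    (φ : EuclideanSpace ℝ (Fin d) → EuclideanSpace ℝ (Fin d))
    (hφ : ContDiff ℝ (⊤ : ℕ∞) φ) (hφs : HasCompactSupport φ) (hφΩ : tsupport φ ⊆ Ω) :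
    (fun t : ℝ =>
        (∫ x, g x * (((fun z => z + t • φ z) '' E).indicator (fun _ => (1 : ℝ)) x
            - E.indicator (fun _ => (1 : ℝ)) x))
          - t * ∫ x in E, vdiv (fun y => g y • φ y) x)
      =O[nhds 0] (fun t : ℝ => t ^ 2) := by
  have hΩc : IsCompact (closure Ω) := hΩb.isCompact_closure
  obtain ⟨δ, hδ, hδΩ⟩ := hφs.isCompact.exists_cthickening_subset_open hΩo hφΩ
  obtain ⟨G, hG, hGg⟩ := exists_cutoff Ω hΩo g hg (Metric.cthickening δ (tsupport φ))
    Metric.isClosed_cthickening hδΩ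
  obtain ⟨B, hB⟩ := hφs.exists_bound_of_continuous hφ.continuous
  obtain ⟨L, hL⟩ := hφ.lipschitzWith_of_hasCompactSupport hφs (by simp)
  obtain ⟨R, hR⟩ := hΩb.subset_closedBall (0 : EuclideanSpace ℝ (Fin d))
  have hB0 : 0 ≤ B := (norm_nonneg _).trans (hB 0)
  -- the Taylor estimates
  obtain ⟨C, hC0, hC⟩ := taylor _ (contDiff_F G hG φ hφ) (max R 1)
  obtain ⟨M, hM⟩ := (contDiff_jacdet φ hφ).contDiffOn.exists_lipschitzOnWith two_ne_zero
    (convex_closedBall (0 : ℝ × EuclideanSpace ℝ (Fin d)) (max R 1)) (isCompact_closedBall _ _)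
  have hmem : ∀ t : ℝ, |t| ≤ 1 → ∀ x ∈ Ω,
      ((t, x) : ℝ × EuclideanSpace ℝ (Fin d)) ∈ Metric.closedBall 0 (max R 1) := by
    intro t ht x hx
    have := hR hx
    rw [mem_closedBall_zero_iff] at this ⊢
    rw [Prod.norm_def]
    exact max_le (ht.trans (le_max_right _ _)) (this.trans (le_max_left _ _))
  -- off the support
  have hoff : ∀ x, x ∉ tsupport φ → φ x = 0 ∧ jac φ x = 0 := by
    intro x hx
    refine ⟨image_eq_zero_of_notMem_tsupport hx, ?_⟩
    have : fderiv ℝ φ x = 0 := by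
      by_contra h
      exact hx (support_fderiv_subset ℝ h)
    ext i j
    simp [jac, this]
  have hgG : (fun y => g y • φ y) = fun y => G y • φ y := by
    ext1 y
    by_cases hy : y ∈ tsupport φ
    · rw [hGg y (Metric.self_subset_cthickening _ hy)]
    · simp [(hoff y hy).1]
  have hvol : volume E < ⊤ := (hΩb.subset hEΩ).measure_lt_top
  have hgΩ : IntegrableOn g Ω := (hg.continuousOn.integrableOn_compact hΩc).mono_set subset_closure
  have hgE : IntegrableOn g E := hgΩ.mono_set hEΩ
  have hdivE : IntegrableOn (vdiv (fun y => g y • φ y)) E := by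
    rw [hgG]
    have hcont : Continuous (vdiv (fun y => G y • φ y)) := by
      have h1 : ContDiff ℝ 2 (fun y => G y • φ y) :=
        hG.smul (contDiff_two hφ)
      have h2 := h1.continuous_fderiv (by norm_num)
      unfold vdiv
      fun_prop
    exact (hcont.continuousOn.integrableOn_compact hΩc).mono_set (hEΩ.trans subset_closure)
  rw [isBigO_iff]
  refine ⟨C * volume.real E, ?_⟩
  have e1 : ∀ᶠ t : ℝ in nhds 0, |t| < 1 := by
    have : Continuous fun t : ℝ => |t| := by fun_prop
    exact this.continuousAt.eventually_lt continuousAt_const (by simp)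
  have e2 : ∀ᶠ t : ℝ in nhds 0, |t| * B < δ := by
    have : Continuous fun t : ℝ => |t| * B := by fun_prop
    exact this.continuousAt.eventually_lt continuousAt_const (by simpa using hδ)
  have e3 : ∀ᶠ t : ℝ in nhds 0, |t| * L < 1 := by
    have : Continuous fun t : ℝ => |t| * (L : ℝ) := by fun_prop
    exact this.continuousAt.eventually_lt continuousAt_const (by simp)
  have e4 : ∀ᶠ t : ℝ in nhds 0, M * |t| < 1 := by
    have : Continuous fun t : ℝ => (M : ℝ) * |t| := by fun_prop
    exact this.continuousAt.eventually_lt continuousAt_const (by simp)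
  filter_upwards [e1, e2, e3, e4] with t t1 t2 t3 t4
  set f : EuclideanSpace ℝ (Fin d) → EuclideanSpace ℝ (Fin d) := fun z => z + t • φ z with hf
  have hfK : ∀ x ∈ tsupport φ, f x ∈ Metric.cthickening δ (tsupport φ) := by
    intro x hx
    refine Metric.mem_cthickening_of_dist_le (f x) x δ _ hx ?_
    simp only [hf, dist_eq_norm, add_sub_cancel_left, norm_smul, Real.norm_eq_abs]
    exact (mul_le_mul_of_nonneg_left (hB x) (abs_nonneg t)).trans t2.le
  have hfΩ : ∀ x ∈ Ω, f x ∈ Ω := by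
    intro x hx
    by_cases hxK : x ∈ tsupport φ
    · exact hδΩ (hfK x hxK)
    · simpa [hf, (hoff x hxK).1] using hx
  have hinj : Set.InjOn f E := by
    intro x _ y _ hxy
    have h1 : x - y = t • (φ y - φ x) := by
      simp only [hf] at hxy
      rw [smul_sub, sub_eq_sub_iff_add_eq_add, hxy]
      abel
    have h2 : ‖x - y‖ ≤ |t| * L * ‖x - y‖ := by
      conv_lhs => rw [h1, norm_smul, Real.norm_eq_abs]
      rw [mul_assoc]
      gcongr
      rw [norm_sub_rev x y]
      exact hL.norm_sub_le y x
    have h3 : ‖x - y‖ = 0 := by nlinarith [norm_nonneg (x - y)]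
    exact sub_eq_zero.1 (norm_eq_zero.1 h3)
  have hder : ∀ x ∈ E, HasFDerivWithinAt f
      (ContinuousLinearMap.id ℝ (EuclideanSpace ℝ (Fin d)) + t • fderiv ℝ φ x) E x := by
    intro x _
    exact ((hasFDerivAt_id x).add
      (((hφ.differentiable (by simp) x).hasFDerivAt).const_smul t)).hasFDerivWithinAt
  have hdet : ∀ x ∈ E, |(ContinuousLinearMap.id ℝ (EuclideanSpace ℝ (Fin d))
      + t • fderiv ℝ φ x).det| = Matrix.det (1 + t • jac φ x) := by
    intro x hx
    rw [det_eq]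
    apply abs_of_nonneg
    have := hM.norm_sub_le (hmem t t1.le x (hEΩ hx)) (hmem 0 (by simp) x (hEΩ hx))
    simp only [zero_smul, add_zero, Matrix.det_one, Prod.mk_sub_mk, sub_self, sub_zero,
      Prod.norm_mk, norm_zero, Real.norm_eq_abs] at this
    rw [max_eq_left (abs_nonneg t)] at this
    have := (abs_le.1 this).1
    linarith
  have hfE : MeasurableSet (f '' E) := measurable_image_of_fderivWithin hE hder hinj
  have hfEΩ : f '' E ⊆ Ω := by
    rintro _ ⟨x, hx, rfl⟩
    exact hfΩ x (hEΩ hx)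
  have hgfE : IntegrableOn g (f '' E) := hgΩ.mono_set hfEΩ
  have hpull := (integrableOn_image_iff_integrableOn_abs_det_fderiv_smul volume hE hder hinj g).1
    hgfE
  have hI1 : (∫ x, g x * ((f '' E).indicator (fun _ => (1 : ℝ)) x
      - E.indicator (fun _ => (1 : ℝ)) x)) = (∫ x in f '' E, g x) - ∫ x in E, g x := by
    rw [← integral_indicator hfE, ← integral_indicator hE, ← integral_sub
      ((integrable_indicator_iff hfE).2 hgfE) ((integrable_indicator_iff hE).2 hgE)]
    refine integral_congr_ae (.of_forall fun x => ?_)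
    by_cases h1 : x ∈ f '' E <;> by_cases h2 : x ∈ E <;>
      simp only [Set.indicator_of_mem, Set.indicator_of_notMem, h1, h2, not_false_eq_true] <;> ring
  rw [hI1, integral_image_eq_integral_abs_det_fderiv_smul volume hE hder hinj g,
    ← integral_sub hpull hgE, ← integral_const_mul]
  have hs := integral_sub (hpull.sub hgE) (hdivE.const_mul t)
  simp only [Pi.sub_apply] at hs
  rw [← hs]
  have hbound := norm_setIntegral_le_of_norm_le_const (μ := volume) (s := E) (C := C * t ^ 2)
    (f := fun x => |(ContinuousLinearMap.id ℝ (EuclideanSpace ℝ (Fin d))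
      + t • fderiv ℝ φ x).det| • g (f x) - g x - t * vdiv (fun y => g y • φ y) x) hvol ?_
  · refine hbound.trans (le_of_eq ?_)
    rw [Real.norm_eq_abs, abs_of_nonneg (sq_nonneg t)]
    ring
  · intro x hx
    rw [hdet x hx, hgG]
    have hT := hC (0, x) (hmem 0 (by simp) x (hEΩ hx)) (t, x) (hmem t t1.le x (hEΩ hx))
    have hsub : ((t, x) : ℝ × EuclideanSpace ℝ (Fin d)) - (0, x) = (t, 0) := by simp
    rw [hsub, fderiv_F G hG φ hφ] at hT
    simp only [zero_smul, add_zero, Matrix.det_one, mul_one, Prod.norm_mk, norm_zero,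
      Real.norm_eq_abs] at hT
    rw [max_eq_left (abs_nonneg t), sq_abs] at hT
    have hEq : Matrix.det (1 + t • jac φ x) • g (f x) - g x =
        G (x + t • φ x) * Matrix.det (1 + t • jac φ x) - G x := by
      by_cases hxK : x ∈ tsupport φ
      · rw [← hGg x (Metric.self_subset_cthickening _ hxK), ← hGg (f x) (hfK x hxK),
          smul_eq_mul, mul_comm]
      · simp [hf, (hoff x hxK).1, (hoff x hxK).2]
    rw [hEq, Real.norm_eq_abs]
    exact hT
end
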